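/- Let A be a 5×5 real matrix of tropical rank 3 such that some row consists of five zeroes, every entry is ≥ 0, and every column contains at least two zero entries. Then the Kapranov rank of A is 3. -/

import Mathlib

open scoped Classical

noncomputable section

/-- The field of generalized Puiseux series: Hahn series with real exponents
and complex coefficients. -/
abbrev Ktilde : Type := HahnSeries ℝ ℂ

/-- The order (least exponent) of a generalized Puiseux series. -/
def ord (x : Ktilde) : ℝ := x.order

/-- The leading coefficient of a generalized Puiseux series. -/
def orc (x : Ktilde) : ℂ := x.coeff x.order

/-- The tropical determinant of a square real matrix. -/
def tropDet {r : ℕ} (A : Matrix (Fin r) (Fin r) ℝ) : ℝ :=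
  sInf {v | ∃ σ : Equiv.Perm (Fin r), v = ∑ i, A i (σ i)}

/-- A square real matrix is tropically singular if the minimum in its
tropical determinant is attained by at least two permutations. -/
def TropSingular {r : ℕ} (A : Matrix (Fin r) (Fin r) ℝ) : Prop :=
  ∃ σ τ : Equiv.Perm (Fin r), σ ≠ τ ∧
    (∑ i, A i (σ i)) = tropDet A ∧ (∑ i, A i (τ i)) = tropDet A

/-- The tropical rank: the largest size of a tropically nonsingular square
submatrix. -/
def tropRank {m n : ℕ} (M : Matrix (Fin m) (Fin n) ℝ) : ℕ :=
  sSup {r | ∃ ri : Fin r → Fin m, ∃ ci : Fin r → Fin n,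
    Function.Injective ri ∧ Function.Injective ci ∧
    ¬ TropSingular (M.submatrix ri ci)}

/-- `F` is a lift of the real matrix `M`: all entries of `F` are nonzero
generalized Puiseux series whose orders are the entries of `M`. -/
def IsLift {m n : ℕ} (F : Matrix (Fin m) (Fin n) Ktilde)
    (M : Matrix (Fin m) (Fin n) ℝ) : Prop :=
  ∀ i j, F i j ≠ 0 ∧ ord (F i j) = M i j

/-- The Kapranov rank: the smallest classical rank of a lift of `M` to the
field of generalized Puiseux series. -/
def kapRank {m n : ℕ} (M : Matrix (Fin m) (Fin n) ℝ) : ℕ :=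
  sInf {r | ∃ F : Matrix (Fin m) (Fin n) Ktilde, IsLift F M ∧ F.rank ≤ r}

/-- The Barvinok rank: the smallest `r` such that `M` is the entrywise
(min-plus) sum of `r` tropical products of a column by a row. -/
def barvRank {m n : ℕ} (M : Matrix (Fin m) (Fin n) ℝ) : ℕ :=
  sInf {r | ∃ (A : Fin r → Fin m → ℝ) (B : Fin r → Fin n → ℝ),
    ∀ i j, IsLeast {v | ∃ l : Fin r, v = A l i + B l j} (M i j)}

section TropicalDependence

variable {ι κ : Type*} [Fintype ι] [Fintype κ]

/-- A monotone map commuting with the addition of constants is nonexpansive for the sup norm. -/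
theorem lipschitzWith_one_of_monotone_of_add_const {f : (ι → ℝ) → ι → ℝ} (hmono : Monotone f)
    (hconst : ∀ p (c : ℝ), f (fun i => p i + c) = fun i => f p i + c) : LipschitzWith 1 f := by
  have key : ∀ p q : ι → ℝ, ∀ i, f p i - f q i ≤ dist p q := by
    intro p q i
    have hle : p ≤ fun k => q k + dist p q := by
      intro k
      have h1 := dist_le_pi_dist p q k
      rw [Real.dist_eq] at h1
      have h2 := le_abs_self (p k - q k)
      show p k ≤ q k + dist p q
      linarith
    have h3 := hmono hle i
    rw [hconst] at h3
    simp only at h3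
    linarith
  refine LipschitzWith.of_dist_le_mul fun p q => ?_
  rw [NNReal.coe_one, one_mul, dist_pi_le_iff dist_nonneg]
  intro i
  rw [Real.dist_eq, abs_sub_le_iff]
  exact ⟨key p q i, dist_comm p q ▸ key q p i⟩

/-- A monotone map `f` commuting with the addition of constants has an additive eigenvector as soon
as each coordinate of `f p` stays within a fixed distance of the coordinates of `p` with a
different index. -/
theorem exists_additive_eigenvector [Nonempty ι] {f : (ι → ℝ) → ι → ℝ} (hmono : Monotone f)
    (hconst : ∀ p (c : ℝ), f (fun i => p i + c) = fun i => f p i + c) {C : ℝ} (hC : 0 ≤ C)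
    (hup : ∀ p i k, k ≠ i → f p i ≤ p k + C) (hlow : ∀ p i, ∃ k, p k - C ≤ f p i) :
    ∃ (p : ι → ℝ) (c : ℝ), ∀ i, f p i = p i + c := by
  have hlip := lipschitzWith_one_of_monotone_of_add_const hmono hconst
  have i₀ : ι := Classical.arbitrary ι
  let H : (ι → ℝ) → ℝ := fun p => ∑ i, |(f p i - p i) - (f p i₀ - p i₀)|
  have hH : Continuous H := by
    have := hlip.continuous
    fun_prop
  have hcomp : IsCompact (Set.Icc (fun _ : ι => -(2 * C)) fun _ => 2 * C) := isCompact_Icc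
  obtain ⟨p, -, hp⟩ := hcomp.exists_isMinOn
    ⟨0, fun _ => by simp [hC], fun _ => by simp [hC]⟩ hH.continuousOn
  -- The fixed points of `a • f` for `a < 1` close to `1` are approximate eigenvectors.
  have happrox : ∀ a : ℝ, 0 < a → a < 1 →
      ∃ q ∈ Set.Icc (fun _ : ι => -(2 * C)) fun _ => 2 * C,
        H q ≤ Fintype.card ι * ((1 - a) / a * (2 * C)) := by
    intro a ha ha1
    have hcontr : ContractingWith ⟨a, ha.le⟩ fun p => a • f p := by
      refine ⟨by exact_mod_cast ha1, LipschitzWith.of_dist_le_mul fun x y => ?_⟩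
      rw [dist_smul₀, Real.norm_of_nonneg ha.le]
      exact mul_le_mul_of_nonneg_left (by simpa using hlip.dist_le_mul x y) ha.le
    set w := hcontr.fixedPoint
    have hw : ∀ i, a * f w i = w i := fun i => congrFun hcontr.fixedPoint_isFixedPt i
    have hspread : ∀ i k, w i - w k ≤ 2 * C := by
      obtain ⟨M, hM⟩ := Finite.exists_max w
      obtain ⟨m, hm⟩ := Finite.exists_min w
      suffices w M - w m ≤ 2 * C from fun i k => by linarith [hM i, hm k]
      by_cases hMm : m = M
      · subst hMm; linarith
      · have h1 := hup w M m hMm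
        obtain ⟨l, hl⟩ := hlow w m
        have h2 := hm l
        have h3 := hw M
        have h4 := hw m
        have h5 : f w M - f w m ≤ 2 * C := by linarith
        nlinarith
    refine ⟨fun i => w i - w i₀, ⟨fun i => ?_, fun i => ?_⟩, ?_⟩
    · have := hspread i₀ i
      show -(2 * C) ≤ w i - w i₀
      linarith
    · exact hspread i i₀
    · have hterm : ∀ i ∈ Finset.univ, |(f (fun i => w i - w i₀) i - (w i - w i₀)) -
          (f (fun i => w i - w i₀) i₀ - (w i₀ - w i₀))| ≤ (1 - a) / a * (2 * C) := by
        intro i _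
        have h1 := hconst w (-w i₀)
        simp only [← sub_eq_add_neg] at h1
        rw [h1]
        have h2 : f w i - w i₀ - (w i - w i₀) - (f w i₀ - w i₀ - (w i₀ - w i₀))
            = (1 - a) / a * (w i - w i₀) := by
          rw [← hw i, ← hw i₀]
          field_simp
          ring
        rw [h2, abs_mul, abs_of_nonneg (div_nonneg (by linarith) ha.le)]
        exact mul_le_mul_of_nonneg_left (abs_sub_le_iff.2 ⟨hspread i i₀, hspread i₀ i⟩)
          (div_nonneg (by linarith) ha.le)
      simpa [H] using Finset.sum_le_card_nsmul _ _ _ hterm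
  have hH0 : H p ≤ 0 := by
    have hlim : Filter.Tendsto (fun a : ℝ => Fintype.card ι * ((1 - a) / a * (2 * C)))
        (nhdsWithin 1 (Set.Iio 1)) (nhds 0) := by
      have : ContinuousAt (fun a : ℝ => Fintype.card ι * ((1 - a) / a * (2 * C))) 1 := by
        fun_prop (disch := norm_num)
      simpa using this.tendsto.mono_left nhdsWithin_le_nhds
    refine ge_of_tendsto hlim ?_
    filter_upwards [Ioo_mem_nhdsLT (zero_lt_one' ℝ)] with a ha
    obtain ⟨q, hq, hqH⟩ := happrox a ha.1 ha.2
    exact (hp hq).trans hqH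
  refine ⟨p, f p i₀ - p i₀, fun i => ?_⟩
  have h1 := Finset.single_le_sum
    (f := fun i => |(f p i - p i) - (f p i₀ - p i₀)|) (fun _ _ => abs_nonneg _) (Finset.mem_univ i)
  have h2 : |(f p i - p i) - (f p i₀ - p i₀)| = 0 := le_antisymm (h1.trans hH0) (abs_nonneg _)
  linarith [abs_eq_zero.1 h2]

/-- Either the rows of a real matrix are tropically dependent, or after a translation of the rows
every row contains the unique minimum of some column. -/
theorem tropically_dependent_or_unique_minima [Nontrivial ι] [Nonempty κ] (a : ι → κ → ℝ) :
    (∃ p : ι → ℝ, ∀ j i, ∃ k, k ≠ i ∧ p k + a k j ≤ p i + a i j) ∨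
      ∃ (p : ι → ℝ) (c : ι → κ), ∀ i k, k ≠ i → p i + a i (c i) < p k + a k (c i) := by
  have hne : ∀ i : ι, (Finset.univ.erase i).Nonempty := fun i => by
    obtain ⟨k, hk⟩ := exists_ne i
    exact ⟨k, by simp [hk]⟩
  let f : (ι → ℝ) → ι → ℝ := fun p i =>
    Finset.univ.sup' Finset.univ_nonempty fun j =>
      (Finset.univ.erase i).inf' (hne i) fun k => p k + a k j - a i j
  have hle : ∀ p i t, f p i ≤ t ↔ ∀ j, ∃ k, k ≠ i ∧ p k + a k j - a i j ≤ t := by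
    intro p i t
    simp [f, Finset.sup'_le_iff, Finset.inf'_le_iff]
  have hge : ∀ p i t, t ≤ f p i ↔ ∃ j, ∀ k, k ≠ i → t ≤ p k + a k j - a i j := by
    intro p i t
    simp [f, Finset.le_sup'_iff, Finset.le_inf'_iff]
  have hmono : Monotone f := by
    intro p q hpq i
    rw [hle]
    intro j
    obtain ⟨k, hk, h⟩ := (hle q i _).1 le_rfl j
    exact ⟨k, hk, by linarith [hpq k]⟩
  have hconst : ∀ p (c : ℝ), f (fun i => p i + c) = fun i => f p i + c := by
    intro p c
    ext i
    apply le_antisymm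
    · rw [hle]
      intro j
      obtain ⟨k, hk, h⟩ := (hle p i _).1 le_rfl j
      exact ⟨k, hk, by linarith⟩
    · rw [← le_sub_iff_add_le, hle]
      intro j
      obtain ⟨k, hk, h⟩ := (hle (fun i => p i + c) i _).1 le_rfl j
      exact ⟨k, hk, by linarith⟩
  obtain ⟨M, hM⟩ := Finite.exists_max fun x : ι × κ => |a x.1 x.2|
  have hbound : ∀ i k j, |a k j - a i j| ≤ 2 * |a M.1 M.2| := fun i k j => by
    linarith [abs_sub (a k j) (a i j), hM (i, j), hM (k, j)]
  obtain ⟨p, c, hp⟩ := exists_additive_eigenvector hmono hconst (C := 2 * |a M.1 M.2|)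
    (by positivity)
    (fun p i k hk => by
      obtain ⟨j, hj⟩ := (hge p i _).1 le_rfl
      linarith [hj k hk, (abs_le.1 (hbound i k j)).2])
    (fun p i => by
      obtain ⟨k, hk, h⟩ := (hle p i _).1 le_rfl (Classical.arbitrary κ)
      exact ⟨k, by linarith [(abs_le.1 (hbound i k (Classical.arbitrary κ))).1]⟩)
  rcases le_or_gt c 0 with hc | hc
  · refine Or.inl ⟨p, fun j i => ?_⟩
    obtain ⟨k, hk, h⟩ := (hle p i _).1 le_rfl j
    exact ⟨k, hk, by linarith [hp i]⟩
  · refine Or.inr ⟨p, ?_⟩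
    choose g hg using fun i => (hge p i _).1 le_rfl
    exact ⟨g, fun i k hk => by linarith [hg i k hk, hp i]⟩

end TropicalDependence

section TropicalRank

open scoped Matrix

theorem tropDet_le {r : ℕ} (A : Matrix (Fin r) (Fin r) ℝ) (σ : Equiv.Perm (Fin r)) :
    tropDet A ≤ ∑ i, A i (σ i) := by
  refine csInf_le (Set.Finite.bddBelow ?_) ⟨σ, rfl⟩
  exact (Set.finite_range fun σ : Equiv.Perm (Fin r) => ∑ i, A i (σ i)).subset
    fun v ⟨τ, hτ⟩ => ⟨τ, hτ.symm⟩

theorem not_tropSingular_iff {r : ℕ} (A : Matrix (Fin r) (Fin r) ℝ) :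
    ¬ TropSingular A ↔
      ∃ σ : Equiv.Perm (Fin r), ∀ τ, τ ≠ σ → ∑ i, A i (σ i) < ∑ i, A i (τ i) := by
  constructor
  · intro h
    obtain ⟨σ, hσ⟩ := Finite.exists_min fun σ : Equiv.Perm (Fin r) => ∑ i, A i (σ i)
    have hdet : ∑ i, A i (σ i) = tropDet A := by
      refine le_antisymm (le_csInf ⟨_, σ, rfl⟩ ?_) (tropDet_le A σ)
      rintro v ⟨τ, rfl⟩
      exact hσ τ
    refine ⟨σ, fun τ hτ => lt_of_le_of_ne (hσ τ) fun heq => ?_⟩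
    exact h ⟨τ, σ, hτ, heq ▸ hdet, hdet⟩
  · rintro ⟨σ, hσ⟩ ⟨τ, τ', hne, h, h'⟩
    have hdet := tropDet_le A σ
    by_cases hτ : τ = σ
    · have := hσ τ' (hτ ▸ hne.symm)
      linarith
    · have := hσ τ hτ
      linarith

variable {m n : ℕ} {A B : Matrix (Fin m) (Fin n) ℝ}

theorem le_tropRank {r : ℕ} {ri : Fin r → Fin m} {ci : Fin r → Fin n}
    (hri : Function.Injective ri) (hci : Function.Injective ci)
    (h : ¬ TropSingular (A.submatrix ri ci)) : r ≤ tropRank A := by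
  refine le_csSup ⟨m, ?_⟩ ⟨ri, ci, hri, hci, h⟩
  rintro s ⟨ri', -, hri', -⟩
  simpa using Fintype.card_le_of_injective ri' hri'

theorem exists_submatrix_tropRank (A : Matrix (Fin m) (Fin n) ℝ) :
    ∃ (ri : Fin (tropRank A) → Fin m) (ci : Fin (tropRank A) → Fin n),
      Function.Injective ri ∧ Function.Injective ci ∧ ¬ TropSingular (A.submatrix ri ci) := by
  refine Nat.sSup_mem (s := {r | ∃ ri : Fin r → Fin m, ∃ ci : Fin r → Fin n,
    Function.Injective ri ∧ Function.Injective ci ∧ ¬ TropSingular (A.submatrix ri ci)}) ?_ ⟨m, ?_⟩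
  · refine ⟨0, Fin.elim0, Fin.elim0, fun i => i.elim0, fun i => i.elim0, ?_⟩
    rintro ⟨σ, τ, h, -⟩
    exact h (Subsingleton.elim _ _)
  · rintro s ⟨ri, -, hri, -⟩
    simpa using Fintype.card_le_of_injective ri hri

theorem tropRank_le_of_row_translate {d : Fin m → ℝ} (h : ∀ i j, B i j = A i j + d i) :
    tropRank B ≤ tropRank A := by
  obtain ⟨ri, ci, hri, hci, hns⟩ := exists_submatrix_tropRank B
  refine le_tropRank hri hci ?_
  rw [not_tropSingular_iff] at hns ⊢
  simpa [h, Finset.sum_add_distrib] using hns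

/-- The tropical rank is a lower bound for the rank of a lift. -/
theorem tropRank_le_rank_of_isLift {F : Matrix (Fin m) (Fin n) Ktilde} (hF : IsLift F A) :
    tropRank A ≤ F.rank := by
  obtain ⟨ri, ci, -, -, hns⟩ := exists_submatrix_tropRank A
  obtain ⟨σ, hσ⟩ := (not_tropSingular_iff _).1 hns
  have hprod : ∀ τ : Equiv.Perm (Fin (tropRank A)),
      ∏ i, F (ri i) (ci (τ i)) ≠ 0 ∧
        (∏ i, F (ri i) (ci (τ i))).order = ∑ i, A (ri i) (ci (τ i)) := by
    intro τ
    induction (Finset.univ : Finset (Fin (tropRank A))) using Finset.cons_induction with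
    | empty => simp
    | cons i s hi ih =>
      rw [Finset.prod_cons, Finset.sum_cons]
      refine ⟨mul_ne_zero (hF _ _).1 ih.1, ?_⟩
      rw [HahnSeries.order_mul (hF _ _).1 ih.1, ih.2]
      exact congrArg (· + _) (hF _ _).2
  have hdet : ((F.submatrix ri ci)ᵀ).det ≠ 0 := by
    intro h0
    have h1 := congrArg (fun x : Ktilde => x.coeff (∑ i, A (ri i) (ci (σ i)))) h0
    simp only [Matrix.det_apply, HahnSeries.coeff_sum, HahnSeries.coeff_zero,
      Matrix.transpose_apply, Matrix.submatrix_apply] at h1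
    rw [Finset.sum_eq_single σ] at h1
    · have h2 : (∏ i, F (ri i) (ci (σ i))).coeff (∑ i, A (ri i) (ci (σ i))) ≠ 0 := by
        rw [← (hprod σ).2]
        exact fun h => (hprod σ).1 (HahnSeries.coeff_order_eq_zero.1 h)
      rcases Int.units_eq_one_or (Equiv.Perm.sign σ) with hs | hs <;> simp [hs, h2] at h1
    · intro τ _ hτ
      have h2 : (∏ i, F (ri i) (ci (τ i))).coeff (∑ i, A (ri i) (ci (σ i))) = 0 := by
        apply HahnSeries.coeff_eq_zero_of_lt_order
        rw [(hprod τ).2]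
        exact hσ τ hτ
      rcases Int.units_eq_one_or (Equiv.Perm.sign τ) with hs | hs <;> simp [hs, h2]
    · simp
  rw [Matrix.det_transpose] at hdet
  have hrank := Matrix.rank_of_isUnit (F.submatrix ri ci)
    ((Matrix.isUnit_iff_isUnit_det _).2 (isUnit_iff_ne_zero.2 hdet))
  rw [Fintype.card_fin] at hrank
  rw [← hrank]
  have h1 : (F.submatrix ri id).rank ≤ F.rank := by
    simpa using Matrix.rank_submatrix_le F ri id
  have h2 : ((F.submatrix ri id).submatrix id ci).rank ≤ (F.submatrix ri id).rank := by
    rw [← Matrix.rank_transpose, ← Matrix.rank_transpose (F.submatrix ri id)]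
    exact Matrix.rank_submatrix_le (F.submatrix ri id)ᵀ ci id
  exact h2.trans h1

/-- If all square submatrices with one row fewer than `A` are tropically singular, then the rows of
`A` different from `r` are tropically dependent. -/
theorem exists_tropical_dependence {A : Matrix (Fin (m + 1)) (Fin n) ℝ} (hm : 2 ≤ m) (hn : 0 < n)
    (hA : tropRank A < m) (r : Fin (m + 1)) :
    ∃ p : Fin (m + 1) → ℝ, ∀ j i, i ≠ r → ∃ k, k ≠ r ∧ k ≠ i ∧ p k + A k j ≤ p i + A i j := by
  have : NeZero n := ⟨hn.ne'⟩
  have : Nontrivial (Fin m) := Fin.nontrivial_iff_two_le.2 hm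
  rcases tropically_dependent_or_unique_minima fun i j => A (r.succAbove i) j with
    ⟨p, hp⟩ | ⟨p, c, hp⟩
  · refine ⟨r.insertNth 0 p, fun j i hi => ?_⟩
    obtain ⟨i, rfl⟩ := Fin.exists_succAbove_eq hi
    obtain ⟨k, hki, hk⟩ := hp j i
    exact ⟨r.succAbove k, Fin.succAbove_ne r k, fun h => hki (Fin.succAbove_right_injective h),
      by simpa using hk⟩
  · refine absurd hA (not_lt.2 (le_tropRank (ri := r.succAbove) (ci := c)
      Fin.succAbove_right_injective ?_ ?_))
    · intro i k hik
      by_contra hne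
      have h1 := hp i k (Ne.symm hne)
      have h2 := hp k i hne
      rw [hik] at h1
      linarith
    · rw [not_tropSingular_iff]
      refine ⟨1, fun τ hτ => ?_⟩
      obtain ⟨i₀, hi₀⟩ : ∃ i, τ i ≠ i := by
        by_contra! h
        exact hτ (Equiv.ext h)
      have hlt : ∑ i, (p (τ i) + A (r.succAbove (τ i)) (c (τ i))) <
          ∑ i, (p i + A (r.succAbove i) (c (τ i))) := by
        refine Finset.sum_lt_sum (fun i _ => ?_) ⟨i₀, Finset.mem_univ _, hp (τ i₀) i₀ hi₀.symm⟩
        by_cases hi : i = τ i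
        · rw [← hi]
        · exact (hp (τ i) i hi).le
      rw [Equiv.sum_comp τ fun i => p i + A (r.succAbove i) (c i), Finset.sum_add_distrib,
        Finset.sum_add_distrib] at hlt
      simpa using hlt

end TropicalRank

section Residue

open HahnSeries

/-- `HasResidue x c` says that `x` has nonnegative order and that its coefficient at `0` is `c`. -/
def HasResidue (x : Ktilde) (c : ℂ) : Prop := 0 < addVal ℝ ℂ (x - C c)

theorem hasResidue_C (c : ℂ) : HasResidue (C c) c := by
  simp [HasResidue]

theorem HasResidue.add {x y : Ktilde} {c d : ℂ} (hx : HasResidue x c) (hy : HasResidue y d) :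
    HasResidue (x + y) (c + d) := by
  unfold HasResidue
  rw [map_add, add_sub_add_comm]
  exact AddValuation.map_lt_add _ hx hy

theorem HasResidue.addVal_nonneg {x : Ktilde} {c : ℂ} (hx : HasResidue x c) :
    0 ≤ addVal ℝ ℂ x := by
  have h : 0 ≤ addVal ℝ ℂ (C c) := by
    rw [addVal_apply]
    exact orderTop_single_le
  simpa using AddValuation.map_le_add _ hx.le h

theorem HasResidue.mul {x y : Ktilde} {c d : ℂ} (hx : HasResidue x c) (hy : HasResidue y d) :
    HasResidue (x * y) (c * d) := by
  have h : x * y - C (c * d) = (x - C c) * y + C c * (y - C d) := by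
    rw [map_mul]; ring
  unfold HasResidue
  rw [h]
  refine AddValuation.map_lt_add _ ?_ ?_
  · rw [AddValuation.map_mul]
    exact lt_of_lt_of_le hx (le_add_of_nonneg_right hy.addVal_nonneg)
  · rw [AddValuation.map_mul]
    exact lt_of_lt_of_le hy (le_add_of_nonneg_left (hasResidue_C c).addVal_nonneg)

theorem HasResidue.neg {x : Ktilde} {c : ℂ} (hx : HasResidue x c) : HasResidue (-x) (-c) := by
  have h : -x - C (-c) = -(x - C c) := by
    ext g
    simp only [coeff_sub, coeff_neg, map_neg]
    ring
  unfold HasResidue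
  rwa [h, AddValuation.map_neg]

theorem HasResidue.sub {x y : Ktilde} {c d : ℂ} (hx : HasResidue x c) (hy : HasResidue y d) :
    HasResidue (x - y) (c - d) := by
  simpa [sub_eq_add_neg] using hx.add hy.neg

theorem hasResidue_sum {ι : Type*} (s : Finset ι) {x : ι → Ktilde} {c : ι → ℂ}
    (h : ∀ i ∈ s, HasResidue (x i) (c i)) : HasResidue (∑ i ∈ s, x i) (∑ i ∈ s, c i) := by
  induction s using Finset.cons_induction with
  | empty => simpa using hasResidue_C 0
  | cons i s hi ih =>
    rw [Finset.sum_cons, Finset.sum_cons]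
    exact (h i (by simp)).add (ih fun k hk => h k (by simp [hk]))

theorem hasResidue_single {a : ℝ} (ha : 0 ≤ a) (c : ℂ) :
    HasResidue (single a c) (if a = 0 then c else 0) := by
  split_ifs with h
  · subst h
    exact hasResidue_C c
  · have ha' : 0 < a := lt_of_le_of_ne ha (Ne.symm h)
    unfold HasResidue
    rw [map_zero, sub_zero, addVal_apply]
    exact lt_orderTop_single ha'

theorem HasResidue.addVal_eq_zero {x : Ktilde} {c : ℂ} (hx : HasResidue x c) (hc : c ≠ 0) :
    addVal ℝ ℂ x = 0 := by
  have h : addVal ℝ ℂ (C c) = 0 := by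
    rw [addVal_apply]
    exact orderTop_single hc
  have h2 : addVal ℝ ℂ (C c) < addVal ℝ ℂ (x - C c) := by rw [h]; exact hx
  have h3 := AddValuation.map_add_eq_of_lt_left _ h2
  rw [add_sub_cancel, h] at h3
  exact h3

theorem HasResidue.ne_zero {x : Ktilde} {c : ℂ} (hx : HasResidue x c) (hc : c ≠ 0) : x ≠ 0 := by
  rintro rfl
  simpa using hx.addVal_eq_zero hc

theorem HasResidue.order_eq_zero {x : Ktilde} {c : ℂ} (hx : HasResidue x c) (hc : c ≠ 0) :
    x.order = 0 := by
  have h := hx.addVal_eq_zero hc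
  rw [addVal_apply_of_ne (hx.ne_zero hc)] at h
  exact_mod_cast h

theorem HasResidue.div {x y : Ktilde} {c d : ℂ} (hx : HasResidue x c) (hy : HasResidue y d)
    (hd : d ≠ 0) : HasResidue (x / y) (c / d) := by
  have h1 : HasResidue (x - y * C (c / d)) 0 := by
    simpa [mul_div_cancel₀ _ hd] using hx.sub (hy.mul (hasResidue_C (c / d)))
  have h2 : x - y * C (c / d) = y * (x / y - C (c / d)) := by
    rw [mul_sub, mul_div_cancel₀ _ (hy.ne_zero hd)]
  unfold HasResidue at h1 ⊢
  rwa [map_zero, sub_zero, h2, AddValuation.map_mul, hy.addVal_eq_zero hd, zero_add] at h1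

theorem cramer_two {K : Type*} [Field K] {s s' z z' : K} (h : s * z' - s' * z ≠ 0) (e e' : K) :
    e + (s * ((s' * e' - z' * e) / (s * z' - s' * z)) +
      s' * ((z * e - s * e') / (s * z' - s' * z))) = 0 ∧
    e' + (z * ((s' * e' - z' * e) / (s * z' - s' * z)) +
      z' * ((z * e - s * e') / (s * z' - s' * z))) = 0 := by
  constructor <;> rw [mul_div_assoc', mul_div_assoc', ← add_div, ← sub_neg_eq_add, sub_eq_zero,
    ← neg_div, eq_div_iff h] <;> ring

/-- Hensel lifting for two linear equations whose reductions are independent on the coordinates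
`i` and `k`. -/
theorem exists_lift_of_two_equations {ι : Type*} [Fintype ι] {s z : ι → Ktilde} {σ ζ ξ : ι → ℂ}
    (hs : ∀ l, HasResidue (s l) (σ l)) (hz : ∀ l, HasResidue (z l) (ζ l))
    (hσ : ∑ l, σ l * ξ l = 0) (hζ : ∑ l, ζ l * ξ l = 0) {i k : ι}
    (hdet : σ i * ζ k - σ k * ζ i ≠ 0) :
    ∃ y : ι → Ktilde, (∀ l, HasResidue (y l) (ξ l)) ∧ ∑ l, s l * y l = 0 ∧ ∑ l, z l * y l = 0 := by
  set D := s i * z k - s k * z i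
  have hD : HasResidue D (σ i * ζ k - σ k * ζ i) :=
    ((hs i).mul (hz k)).sub ((hs k).mul (hz i))
  have hD0 : s i * z k - s k * z i ≠ 0 := hD.ne_zero hdet
  set E₁ := ∑ l, s l * C (ξ l) with hE₁
  set E₂ := ∑ l, z l * C (ξ l) with hE₂
  have hE₁r : HasResidue E₁ 0 :=
    hσ ▸ hasResidue_sum _ fun l _ => (hs l).mul (hasResidue_C (ξ l))
  have hE₂r : HasResidue E₂ 0 :=
    hζ ▸ hasResidue_sum _ fun l _ => (hz l).mul (hasResidue_C (ξ l))
  have hnum₁ : HasResidue ((s k * E₂ - z k * E₁) / D) 0 := by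
    simpa using (((hs k).mul hE₂r).sub ((hz k).mul hE₁r)).div hD hdet
  have hnum₂ : HasResidue ((z i * E₁ - s i * E₂) / D) 0 := by
    simpa using (((hz i).mul hE₁r).sub ((hs i).mul hE₂r)).div hD hdet
  have hsum : ∀ t : ι → Ktilde, ∑ l, t l * (C (ξ l) +
      ((if l = i then (s k * E₂ - z k * E₁) / D else 0) +
        if l = k then (z i * E₁ - s i * E₂) / D else 0)) =
      ∑ l, t l * C (ξ l) + (t i * ((s k * E₂ - z k * E₁) / D) +
        t k * ((z i * E₁ - s i * E₂) / D)) := by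
    intro t
    simp [mul_add, Finset.sum_add_distrib]
  refine ⟨fun l => C (ξ l) + ((if l = i then (s k * E₂ - z k * E₁) / D else 0) +
    if l = k then (z i * E₁ - s i * E₂) / D else 0), fun l => ?_, ?_, ?_⟩
  · have h0 : HasResidue 0 0 := by simpa using hasResidue_C 0
    have h1 : HasResidue (if l = i then (s k * E₂ - z k * E₁) / D else 0) 0 := by
      split_ifs <;> assumption
    have h2 : HasResidue (if l = k then (z i * E₁ - s i * E₂) / D else 0) 0 := by
      split_ifs <;> assumption
    simpa using (hasResidue_C (ξ l)).add (h1.add h2)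
  · rw [hsum, ← hE₁]
    exact (cramer_two hD0 E₁ E₂).1
  · rw [hsum, ← hE₂]
    exact (cramer_two hD0 E₁ E₂).2

end Residue

section ColumnLift

/-- The solution space of two linear equations contains a vector without zero coordinates unless
some coordinate functional is a combination of the two equations. -/
theorem exists_solution_forall_ne_zero {ι : Type*} [Fintype ι] [DecidableEq ι] {σ ζ : ι → ℂ}
    (h : ∀ l (a b : ℂ), ∃ m, a * σ m + b * ζ m ≠ if m = l then 1 else 0) :
    ∃ ξ : ι → ℂ, (∀ l, ξ l ≠ 0) ∧ ∑ l, σ l * ξ l = 0 ∧ ∑ l, ζ l * ξ l = 0 := by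
  let φ : Fin 2 → (ι → ℂ) →ₗ[ℂ] ℂ := ![∑ l, σ l • LinearMap.proj l, ∑ l, ζ l • LinearMap.proj l]
  let W : Submodule ℂ (ι → ℂ) := ⨅ t, LinearMap.ker (φ t)
  by_contra! hcon
  have hcover : ⋃ l, ((Submodule.comap W.subtype
      (LinearMap.ker (LinearMap.proj l : (ι → ℂ) →ₗ[ℂ] ℂ)) : Submodule ℂ W) : Set W) =
        Set.univ := by
    refine Set.eq_univ_of_forall fun w => ?_
    rw [Set.mem_iUnion]
    by_contra! hw
    have hmem := w.2
    simp only [W, Submodule.mem_iInf, LinearMap.mem_ker] at hmem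
    refine hcon w.1 (fun l => by simpa using hw l) ?_ ?_
    · simpa [φ] using hmem 0
    · simpa [φ] using hmem 1
  obtain ⟨l, hl⟩ := Subspace.exists_eq_top_of_iUnion_eq_univ hcover
  have hle : W ≤ LinearMap.ker (LinearMap.proj l : (ι → ℂ) →ₗ[ℂ] ℂ) :=
    Submodule.comap_subtype_eq_top.1 hl
  have hspan := mem_span_of_iInf_ker_le_ker hle
  rw [Submodule.mem_span_range_iff_exists_fun] at hspan
  obtain ⟨c, hc⟩ := hspan
  obtain ⟨m, hm⟩ := h l (c 0) (c 1)
  apply hm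
  have := LinearMap.congr_fun hc (Pi.single m 1)
  simpa [φ, Fin.sum_univ_two, Pi.single_apply, eq_comm] using this

/-- Two equations with supports `S` and `Z` and generic coefficients have a common solution without
zero coordinates. -/
theorem exists_generic_solution {ι : Type*} [Fintype ι] [DecidableEq ι] {S Z : Finset ι}
    {β : ι → ℂ} (hβ : Function.Injective β) (hβ₀ : ∀ l, β l ≠ 0) (hS : 1 < S.card)
    (hZ : 1 < Z.card) (hSZ : ¬ (S = Z ∧ S.card = 2)) :
    ∃ ξ : ι → ℂ, (∀ l, ξ l ≠ 0) ∧ ∑ l, (if l ∈ S then 1 else 0) * ξ l = 0 ∧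
      ∑ l, (if l ∈ Z then β l else 0) * ξ l = 0 := by
  refine exists_solution_forall_ne_zero fun l a b => ?_
  by_contra! h
  obtain ⟨s, hsS, hsl⟩ := Finset.exists_mem_ne hS l
  obtain ⟨z, hzZ, hzl⟩ := Finset.exists_mem_ne hZ l
  have hb : b ≠ 0 := by
    rintro rfl
    have h1 := h l
    have h2 := h s
    simp only [hsS, hsl, if_true, if_false] at h1 h2
    have ha : a = 0 := by simpa using h2
    simp [ha] at h1
  have ha : a ≠ 0 := by
    rintro rfl
    have h2 := h z
    simp only [hzZ, hzl, if_true, if_false] at h2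
    simp [hb, hβ₀] at h2
  have hmem : ∀ m, m ≠ l → m ∈ S ∨ m ∈ Z → a + b * β m = 0 := by
    intro m hml hm
    have h1 := h m
    by_cases hmS : m ∈ S <;> by_cases hmZ : m ∈ Z <;> simp_all
  have huniq : ∀ m, m ∈ S ∨ m ∈ Z → m = l ∨ m = s := by
    intro m hm
    by_contra! hne
    have h1 := hmem m hne.1 hm
    have h2 := hmem s hsl (Or.inl hsS)
    exact hne.2 (hβ (mul_left_cancel₀ hb (by linear_combination h1 - h2)))
  have hcard : ({l, s} : Finset ι).card = 2 := Finset.card_pair hsl.symm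
  have hSeq : S = {l, s} := Finset.eq_of_subset_of_card_le
    (fun m hm => by simpa using huniq m (Or.inl hm)) (by omega)
  have hZeq : Z = {l, s} := Finset.eq_of_subset_of_card_le
    (fun m hm => by simpa using huniq m (Or.inr hm)) (by omega)
  exact hSZ ⟨hSeq.trans hZeq.symm, by rw [hSeq, hcard]⟩

/-- `IsMinAvoiding r x i` says that `i ≠ r` and that `x` attains its minimum over the indices
different from `r` at `i`. -/
def IsMinAvoiding {ι : Type*} (r : ι) (x : ι → ℝ) (i : ι) : Prop :=
  i ≠ r ∧ ∀ k, k ≠ r → x i ≤ x k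

open HahnSeries in
/-- Lifting a real vector to a common solution of a linear equation not involving the coordinate
`r`, with coefficients of orders `p`, and a generic linear equation with constant coefficients. -/
theorem exists_column_lift {ι : Type*} [Fintype ι] [DecidableEq ι] [Nontrivial ι] {r : ι} {p v : ι → ℝ} {β : ι → ℂ}
    (hβ : Function.Injective β) (hβ₀ : ∀ l, β l ≠ 0) (hv : ∀ i, 0 ≤ v i)
    (hzero : ∃ i i', i ≠ i' ∧ v i = 0 ∧ v i' = 0)
    (hp : ∀ i, i ≠ r → ∃ k, k ≠ r ∧ k ≠ i ∧ p k + v k ≤ p i + v i)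
    (hgen : ∀ i i', i ≠ i' → (∀ l, v l = 0 ↔ l = i ∨ l = i') →
      ¬ ∀ l, IsMinAvoiding r (p + v) l ↔ l = i ∨ l = i') :
    ∃ x : ι → Ktilde, (∀ l, x l ≠ 0 ∧ ord (x l) = v l) ∧
      ∑ l, (if l = r then 0 else single (p l) 1) * x l = 0 ∧ ∑ l, C (β l) * x l = 0 := by
  let Z : Finset ι := Finset.univ.filter fun l => v l = 0
  let S : Finset ι := Finset.univ.filter fun l => IsMinAvoiding r (p + v) l
  have hmemZ : ∀ l, l ∈ Z ↔ v l = 0 := fun l => by simp [Z]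
  have hmemS : ∀ l, l ∈ S ↔ IsMinAvoiding r (p + v) l := fun l => by simp [S]
  have hZ : 1 < Z.card := by
    obtain ⟨i, i', hne, hi, hi'⟩ := hzero
    exact Finset.one_lt_card.2 ⟨i, (hmemZ i).2 hi, i', (hmemZ i').2 hi', hne⟩
  obtain ⟨i, hi⟩ : ∃ i, IsMinAvoiding r (p + v) i := by
    obtain ⟨t, ht⟩ := exists_ne r
    obtain ⟨i, hi, hmin⟩ := Finset.exists_min_image (Finset.univ.filter fun l => l ≠ r) (p + v)
      ⟨t, by simp [ht]⟩
    exact ⟨i, by simpa using hi, fun k hk => hmin k (by simp [hk])⟩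
  have hS : 1 < S.card := by
    obtain ⟨k, hkr, hki, hk⟩ := hp i hi.1
    exact Finset.one_lt_card.2 ⟨i, (hmemS i).2 hi, k,
      (hmemS k).2 ⟨hkr, fun l hl => le_trans hk (hi.2 l hl)⟩, hki.symm⟩
  have hSZ : ¬ (S = Z ∧ S.card = 2) := by
    rintro ⟨heq, hcard⟩
    obtain ⟨a, b, hab, hSab⟩ := Finset.card_eq_two.1 hcard
    refine hgen a b hab (fun l => ?_) fun l => ?_
    · rw [← hmemZ, ← heq, hSab]; simp
    · rw [← hmemS, hSab]; simp
  obtain ⟨ξ, hξ, hξS, hξZ⟩ := exists_generic_solution hβ hβ₀ hS hZ hSZ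
  obtain ⟨k, hkZ, hki⟩ := Finset.exists_mem_ne hZ i
  set M := p i + v i
  have hs : ∀ l, HasResidue (if l = r then 0 else single (p l + v l - M) 1)
      (if l ∈ S then 1 else 0) := by
    intro l
    by_cases hl : l = r
    · have hlS : l ∉ S := fun h => ((hmemS l).1 h).1 hl
      simpa [hl, hl ▸ hlS] using hasResidue_C 0
    · have hle : M ≤ p l + v l := hi.2 l hl
      have hiff : l ∈ S ↔ p l + v l - M = 0 := by
        rw [hmemS, sub_eq_zero]
        exact ⟨fun h => le_antisymm (h.2 i hi.1) hle, fun h => ⟨hl, fun k hk => le_trans h.le (hi.2 k hk)⟩⟩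
      simpa [hl, hiff] using hasResidue_single (sub_nonneg.2 hle) 1
  have hz : ∀ l, HasResidue (single (v l) (β l)) (if l ∈ Z then β l else 0) := fun l => by
    simpa [hmemZ] using hasResidue_single (hv l) (β l)
  obtain ⟨y, hy, hy₁, hy₂⟩ := exists_lift_of_two_equations hs hz hξS hξZ (i := i) (k := k) (by
    have h1 : β k - β i ≠ 0 := sub_ne_zero.2 fun h => hki (hβ h)
    by_cases hkS : k ∈ S <;> by_cases hiZ : i ∈ Z <;>
      simp [(hmemS i).2 hi, hkZ, hkS, hiZ, hβ₀, h1])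
  refine ⟨fun l => single (v l) 1 * y l, fun l => ⟨?_, ?_⟩, ?_, ?_⟩
  · exact mul_ne_zero (single_ne_zero one_ne_zero) ((hy l).ne_zero (hξ l))
  · unfold ord
    rw [order_mul (single_ne_zero one_ne_zero) ((hy l).ne_zero (hξ l)), order_single one_ne_zero,
      (hy l).order_eq_zero (hξ l), add_zero]
  · have hterm : ∀ l, (if l = r then 0 else single (p l) 1) * (single (v l) 1 * y l) =
        single M (1 : ℂ) * ((if l = r then 0 else single (p l + v l - M) 1) * y l) := by
      intro l
      by_cases hl : l = r
      · simp [hl]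
      · simp only [hl, if_false]
        rw [← mul_assoc, ← mul_assoc, single_mul_single, single_mul_single]
        congr 3
        ring
    simp_rw [hterm]
    rw [← Finset.mul_sum, hy₁, mul_zero]
  · rw [← hy₂]
    refine Finset.sum_congr rfl fun l _ => ?_
    rw [← mul_assoc, C_apply, single_mul_single, zero_add, mul_one]

open Matrix in
/-- Two independent linear relations between the rows bound the rank. -/
theorem rank_add_two_le_of_vecMul_eq_zero {K : Type*} [Field K] {m n : ℕ}
    {F : Matrix (Fin m) (Fin n) K} {P Q : Fin m → K} (hP : P ᵥ* F = 0) (hQ : Q ᵥ* F = 0)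
    (hP₀ : P ≠ 0) {r : Fin m} (hPr : P r = 0) (hQr : Q r ≠ 0) : F.rank + 2 ≤ m := by
  have hind : LinearIndependent K ![P, Q] := by
    rw [LinearIndependent.pair_iff]
    intro s t hst
    have ht : t = 0 := by simpa [hPr, hQr] using congrFun hst r
    exact ⟨by simpa [ht, hP₀] using hst, ht⟩
  have hspan : Submodule.span K (Set.range ![P, Q]) ≤ LinearMap.ker Fᵀ.mulVecLin := by
    rw [Submodule.span_le]
    rintro _ ⟨t, rfl⟩
    fin_cases t <;> simp [hP, hQ]
  have h1 := Submodule.finrank_mono hspan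
  rw [finrank_span_eq_card hind, Fintype.card_fin] at h1
  have h2 := Fᵀ.mulVecLin.finrank_range_add_finrank_ker
  rw [Module.finrank_fin_fun] at h2
  have h3 : F.rank = Module.finrank K (LinearMap.range Fᵀ.mulVecLin) := (rank_transpose F).symm
  omega

open HahnSeries in
/-- A nonnegative matrix with two zeros in every column has a lift of corank at least two if its
rows different from `r` have a tropical dependence in general position. -/
theorem exists_isLift_rank_le {m n : ℕ} {A : Matrix (Fin (m + 2)) (Fin n) ℝ}
    (hnonneg : ∀ i j, 0 ≤ A i j) (hcol : ∀ j, ∃ i i', i ≠ i' ∧ A i j = 0 ∧ A i' j = 0)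
    {r : Fin (m + 2)} {p : Fin (m + 2) → ℝ}
    (hp : ∀ j i, i ≠ r → ∃ k, k ≠ r ∧ k ≠ i ∧ p k + A k j ≤ p i + A i j)
    (hgen : ∀ j i i', i ≠ i' → (∀ l, A l j = 0 ↔ l = i ∨ l = i') →
      ¬ ∀ l, IsMinAvoiding r (fun k => p k + A k j) l ↔ l = i ∨ l = i') :
    ∃ F : Matrix (Fin (m + 2)) (Fin n) Ktilde, IsLift F A ∧ F.rank ≤ m := by
  have hβ : Function.Injective fun l : Fin (m + 2) => ((l : ℕ) : ℂ) + 1 := fun a b h => by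
    simpa [Fin.ext_iff] using h
  have hβ₀ : ∀ l : Fin (m + 2), ((l : ℕ) : ℂ) + 1 ≠ 0 := fun l => Nat.cast_add_one_ne_zero _
  choose x hx hxP hxQ using fun j => exists_column_lift (v := fun i => A i j) (p := p) (r := r)
    hβ hβ₀ (fun i => hnonneg i j) (hcol j) (hp j) (hgen j)
  refine ⟨Matrix.of fun i j => x j i, fun i j => hx j i, ?_⟩
  obtain ⟨t, ht⟩ := exists_ne r
  have := rank_add_two_le_of_vecMul_eq_zero (F := Matrix.of fun i j => x j i)
    (P := fun l => if l = r then 0 else single (p l) 1) (Q := fun l => C (((l : ℕ) : ℂ) + 1))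
    (funext fun j => hxP j) (funext fun j => hxQ j) (fun h => by simpa [ht] using congrFun h t) (r := r) (by simp)
    (by simpa only [ne_eq, map_eq_zero] using hβ₀ r)
  omega

end ColumnLift

section ZeroPatterns

variable {A : Matrix (Fin 5) (Fin 5) ℝ}

/-- Suppose that two columns `u`, `w` have exactly one zero each outside the row `i₀`, in the rows
`i₃` and `i₄`. Then every zero of the row `i₁` gives a zero of the row `i₂`. -/
theorem eq_zero_of_eq_zero_of_tropRank_lt_four (hA : tropRank A < 4) (hnonneg : ∀ i j, 0 ≤ A i j)
    {i₁ i₂ i₃ i₄ u w : Fin 5} (h₁₂ : i₁ ≠ i₂) (h₁₃ : i₁ ≠ i₃) (h₁₄ : i₁ ≠ i₄) (h₂₃ : i₂ ≠ i₃)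
    (h₂₄ : i₂ ≠ i₄) (h₃₄ : i₃ ≠ i₄)
    (hu₁ : A i₁ u ≠ 0) (hu₂ : A i₂ u ≠ 0) (hu₃ : A i₃ u = 0) (hu₄ : A i₄ u ≠ 0)
    (hw₁ : A i₁ w ≠ 0) (hw₂ : A i₂ w ≠ 0) (hw₃ : A i₃ w ≠ 0) (hw₄ : A i₄ w = 0)
    (hrow : ∃ j, A i₂ j = 0) {c : Fin 5} (hc : A i₁ c = 0) : A i₂ c = 0 := by
  obtain ⟨d, hd⟩ := hrow
  by_contra hc₂
  refine absurd hA (not_lt.2 ?_)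
  have hcu : c ≠ u := by rintro rfl; exact hu₁ hc
  have hcw : c ≠ w := by rintro rfl; exact hw₁ hc
  have hcd : c ≠ d := by rintro rfl; exact hc₂ hd
  have hdu : d ≠ u := by rintro rfl; exact hu₂ hd
  have hdw : d ≠ w := by rintro rfl; exact hw₂ hd
  have huw : u ≠ w := by rintro rfl; exact hw₃ hu₃
  refine le_tropRank (ri := ![i₁, i₂, i₃, i₄]) (ci := ![c, d, u, w]) ?_ ?_ ?_
  · intro a b hab
    fin_cases a <;> fin_cases b <;> simp_all
  · intro a b hab
    fin_cases a <;> fin_cases b <;> simp_all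
  · rw [not_tropSingular_iff]
    refine ⟨1, fun τ hτ => ?_⟩
    by_contra! hle
    have hsum : ∑ i, A (![i₁, i₂, i₃, i₄] i) (![c, d, u, w] (τ i)) = 0 := by
      refine le_antisymm (hle.trans ?_) (Finset.sum_nonneg fun i _ => hnonneg _ _)
      simp [Fin.sum_univ_four, hc, hd, hu₃, hw₄]
    rw [Finset.sum_eq_zero_iff_of_nonneg fun i _ => hnonneg _ _] at hsum
    have hzero : ∀ k, A (![i₁, i₂, i₃, i₄] (τ.symm k)) (![c, d, u, w] k) = 0 := fun k => by
      simpa using hsum (τ.symm k) (Finset.mem_univ _)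
    have h₂ : τ.symm 2 = 2 := by
      have := hzero 2
      generalize τ.symm 2 = t at this
      fin_cases t <;> simp_all
    have h₃ : τ.symm 3 = 3 := by
      have := hzero 3
      generalize τ.symm 3 = t at this
      fin_cases t <;> simp_all
    have h₀ : τ.symm 0 = 0 := by
      have h := hzero 0
      have hne₂ : τ.symm 0 ≠ 2 := h₂ ▸ τ.symm.injective.ne (by decide)
      have hne₃ : τ.symm 0 ≠ 3 := h₃ ▸ τ.symm.injective.ne (by decide)
      generalize τ.symm 0 = t at h hne₂ hne₃
      fin_cases t <;> simp_all
    have h₁ : τ.symm 1 = 1 := by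
      have hne₀ : τ.symm 1 ≠ 0 := h₀ ▸ τ.symm.injective.ne (by decide)
      have hne₂ : τ.symm 1 ≠ 2 := h₂ ▸ τ.symm.injective.ne (by decide)
      have hne₃ : τ.symm 1 ≠ 3 := h₃ ▸ τ.symm.injective.ne (by decide)
      generalize τ.symm 1 = t at hne₀ hne₂ hne₃
      fin_cases t <;> simp_all
    refine hτ (Equiv.symm_bijective.injective (Equiv.ext fun k => ?_))
    fin_cases k <;> assumption

/-- Consequences of a tropical dependence between the rows different from `i₄` which fails to be in
general position at the column `u`. -/
theorem exists_separating_value (hnonneg : ∀ i j, 0 ≤ A i j)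
    {i₀ i₁ i₂ i₃ i₄ u w c : Fin 5} (hall : ∀ l, l = i₀ ∨ l = i₁ ∨ l = i₂ ∨ l = i₃ ∨ l = i₄)
    (h₀₁ : i₀ ≠ i₁) (h₀₂ : i₀ ≠ i₂) (h₀₄ : i₀ ≠ i₄) (h₁₃ : i₁ ≠ i₃) (h₁₄ : i₁ ≠ i₄)
    (h₂₃ : i₂ ≠ i₃) (h₂₄ : i₂ ≠ i₄) (h₃₄ : i₃ ≠ i₄) (hrow : ∀ j, A i₀ j = 0)
    (hu₃ : A i₃ u = 0) (hw₁ : 0 < A i₁ w) (hw₂ : 0 < A i₂ w) (hw₃ : A i₃ w ≠ 0)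
    (hc₁ : A i₁ c = 0) (hc₂ : A i₂ c = 0) {p : Fin 5 → ℝ}
    (hp : ∀ j i, i ≠ i₄ → ∃ k, k ≠ i₄ ∧ k ≠ i ∧ p k + A k j ≤ p i + A i j)
    (hbad : ∀ l, IsMinAvoiding i₄ (fun k => p k + A k u) l ↔ l = i₀ ∨ l = i₃) :
    ∃ e, (e < A i₁ u ∧ e < A i₂ u) ∧ ∀ j, A i₃ j ≠ 0 → ¬ (e < A i₁ j ∧ e < A i₂ j) := by
  have hmin₀ := ((hbad i₀).2 (Or.inl rfl)).2
  have hmin₃ := ((hbad i₃).2 (Or.inr rfl)).2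
  simp only at hmin₀ hmin₃
  have hp₀₃ : p i₀ = p i₃ := by linarith [hmin₀ i₃ h₃₄, hmin₃ i₀ h₀₄, hrow u]
  have hlt : ∀ i, i ≠ i₀ → i ≠ i₃ → i ≠ i₄ → p i₀ < p i + A i u := by
    intro i hi₀ hi₃ hi₄
    by_contra! hle
    rcases (hbad i).1 ⟨hi₄, fun k hk => by linarith [hmin₀ k hk, hrow u]⟩ with h | h
    exacts [hi₀ h, hi₃ h]
  have hlt₁ := hlt i₁ h₀₁.symm h₁₃ h₁₄
  have hlt₂ := hlt i₂ h₀₂.symm h₂₃ h₂₄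
  have hcol : ∀ j, A i₃ j ≠ 0 → p i₁ + A i₁ j ≤ p i₀ ∨ p i₂ + A i₂ j ≤ p i₀ := by
    intro j hj
    obtain ⟨k, hk₄, hk₀, hk⟩ := hp j i₀ h₀₄
    rw [hrow, add_zero] at hk
    rcases hall k with rfl | rfl | rfl | rfl | rfl
    · exact absurd rfl hk₀
    · exact Or.inl hk
    · exact Or.inr hk
    · exact absurd (le_antisymm (by linarith) (hnonneg _ _)) hj
    · exact absurd rfl hk₄
  have hle₁ : p i₁ < p i₀ → p i₂ ≤ p i₁ := by
    intro h
    obtain ⟨k, hk₄, hk₁, hk⟩ := hp c i₁ h₁₄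
    have hk' := hnonneg k c
    rcases hall k with rfl | rfl | rfl | rfl | rfl
    · linarith
    · exact absurd rfl hk₁
    · linarith
    · linarith
    · exact absurd rfl hk₄
  have hle₂ : p i₂ < p i₀ → p i₁ ≤ p i₂ := by
    intro h
    obtain ⟨k, hk₄, hk₂, hk⟩ := hp c i₂ h₂₄
    have hk' := hnonneg k c
    rcases hall k with rfl | rfl | rfl | rfl | rfl
    · linarith
    · linarith
    · exact absurd rfl hk₂
    · linarith
    · exact absurd rfl hk₄
  have heq : p i₁ = p i₂ := by
    rcases hcol w hw₃ with h | h
    · have h' := hle₁ (by linarith)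
      exact le_antisymm (hle₂ (by linarith)) h'
    · have h' := hle₂ (by linarith)
      exact le_antisymm h' (hle₁ (by linarith))
  refine ⟨p i₀ - p i₁, ⟨by linarith, by linarith⟩, fun j hj ⟨h₁, h₂⟩ => ?_⟩
  rcases hcol j hj with h | h <;> linarith

/-- A normalized nonnegative matrix of tropical rank less than four has a row `r` such that the other
rows have a tropical dependence in general position. -/
theorem exists_generic_dependence (hA : tropRank A < 4) (hnonneg : ∀ i j, 0 ≤ A i j) {i₀ : Fin 5}
    (hrow : ∀ j, A i₀ j = 0) (hzero : ∀ i, ∃ j, A i j = 0) :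
    ∃ (r : Fin 5) (p : Fin 5 → ℝ),
      (∀ j i, i ≠ r → ∃ k, k ≠ r ∧ k ≠ i ∧ p k + A k j ≤ p i + A i j) ∧
      ∀ j i i', i ≠ i' → (∀ l, A l j = 0 ↔ l = i ∨ l = i') →
        ¬ ∀ l, IsMinAvoiding r (fun k => p k + A k j) l ↔ l = i ∨ l = i' := by
  have hdep := exists_tropical_dependence (m := 4) (by norm_num) (by norm_num) hA
  have hbad : ∀ (r : Fin 5) (p : Fin 5 → ℝ),
      (∀ j i, i ≠ r → ∃ k, k ≠ r ∧ k ≠ i ∧ p k + A k j ≤ p i + A i j) →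
      (∀ j i, i ≠ i₀ → (∀ l, A l j = 0 ↔ l = i₀ ∨ l = i) →
        (∀ l, IsMinAvoiding r (fun k => p k + A k j) l ↔ l = i₀ ∨ l = i) → i = r) →
      ∃ (r : Fin 5) (p : Fin 5 → ℝ),
      (∀ j i, i ≠ r → ∃ k, k ≠ r ∧ k ≠ i ∧ p k + A k j ≤ p i + A i j) ∧
      ∀ j i i', i ≠ i' → (∀ l, A l j = 0 ↔ l = i ∨ l = i') →
        ¬ ∀ l, IsMinAvoiding r (fun k => p k + A k j) l ↔ l = i ∨ l = i' := by
    refine fun r p hp h => ⟨r, p, hp, fun j i i' hne hZ hS => ?_⟩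
    rcases (hZ i₀).1 (hrow j) with rfl | rfl
    · exact ((hS i').2 (Or.inr rfl)).1 (h j i' hne.symm hZ hS)
    · simp only [or_comm (b := _ = i₀)] at hZ hS
      exact ((hS i).2 (Or.inr rfl)).1 (h j i hne hZ hS)
  by_cases hthin : ∃ r, ∀ j i, i ≠ i₀ → (∀ l, A l j = 0 ↔ l = i₀ ∨ l = i) → i = r
  · obtain ⟨r, hr⟩ := hthin
    obtain ⟨p, hp⟩ := hdep r
    exact hbad r p hp fun j i hi hZ _ => hr j i hi hZ
  · push Not at hthin
    obtain ⟨u, i₃, h₃₀, hu, -⟩ := hthin i₀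
    obtain ⟨w, i₄, h₄₀, hw, h₄₃⟩ := hthin i₃
    obtain ⟨i₁, i₂, h₁₂, h₁₀, h₁₃, h₁₄, h₂₀, h₂₃, h₂₄, hall⟩ : ∃ i₁ i₂ : Fin 5, i₁ ≠ i₂ ∧
        i₁ ≠ i₀ ∧ i₁ ≠ i₃ ∧ i₁ ≠ i₄ ∧ i₂ ≠ i₀ ∧ i₂ ≠ i₃ ∧ i₂ ≠ i₄ ∧
        ∀ l, l = i₀ ∨ l = i₁ ∨ l = i₂ ∨ l = i₃ ∨ l = i₄ := by
      clear hthin hu hw hbad hdep hrow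
      revert i₀ i₃ i₄
      decide
    have hu' : ∀ l, l ≠ i₀ → l ≠ i₃ → A l u ≠ 0 := fun l h h' h0 => by
      rcases (hu l).1 h0 with h1 | h1
      exacts [h h1, h' h1]
    have hw' : ∀ l, l ≠ i₀ → l ≠ i₄ → A l w ≠ 0 := fun l h h' h0 => by
      rcases (hw l).1 h0 with h1 | h1
      exacts [h h1, h' h1]
    have hu₃ : A i₃ u = 0 := (hu i₃).2 (Or.inr rfl)
    have hw₄ : A i₄ w = 0 := (hw i₄).2 (Or.inr rfl)
    have hu₁ := hu' i₁ h₁₀ h₁₃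
    have hu₂ := hu' i₂ h₂₀ h₂₃
    have hu₄ := hu' i₄ h₄₀ h₄₃
    have hw₁ := hw' i₁ h₁₀ h₁₄
    have hw₂ := hw' i₂ h₂₀ h₂₄
    have hw₃ := hw' i₃ h₃₀ h₄₃.symm
    have hiff : ∀ c, A i₁ c = 0 ↔ A i₂ c = 0 := fun c =>
      ⟨eq_zero_of_eq_zero_of_tropRank_lt_four hA hnonneg h₁₂ h₁₃ h₁₄ h₂₃ h₂₄ h₄₃.symm
        hu₁ hu₂ hu₃ hu₄ hw₁ hw₂ hw₃ hw₄ (hzero i₂),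
      eq_zero_of_eq_zero_of_tropRank_lt_four hA hnonneg h₁₂.symm h₂₃ h₂₄ h₁₃ h₁₄ h₄₃.symm
        hu₂ hu₁ hu₃ hu₄ hw₂ hw₁ hw₃ hw₄ (hzero i₁)⟩
    have hne : ∀ j i, (∀ l, A l j = 0 ↔ l = i₀ ∨ l = i) → i ≠ i₁ ∧ i ≠ i₂ := by
      refine fun j i hZ => ⟨?_, ?_⟩
      · rintro rfl
        rcases (hZ i₂).1 ((hiff j).1 ((hZ i).2 (Or.inr rfl))) with h | h
        exacts [h₂₀ h, h₁₂ h.symm]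
      · rintro rfl
        rcases (hZ i₁).1 ((hiff j).2 ((hZ i).2 (Or.inr rfl))) with h | h
        exacts [h₁₀ h, h₁₂ h]
    obtain ⟨c, hc₁⟩ := hzero i₁
    have hc₂ := (hiff c).1 hc₁
    obtain ⟨p, hp⟩ := hdep i₄
    obtain ⟨q, hq⟩ := hdep i₃
    by_contra hcon
    have hpbad := mt (hbad i₄ p hp) hcon
    have hqbad := mt (hbad i₃ q hq) hcon
    push Not at hpbad hqbad
    obtain ⟨u', i, hi₀, hZ, hS, hi₄⟩ := hpbad
    obtain ⟨w', i', hi₀', hZ', hS', hi₃'⟩ := hqbad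
    obtain rfl : i = i₃ := by
      rcases hall i with h | h | h | h | h
      exacts [absurd h hi₀, absurd h (hne _ _ hZ).1, absurd h (hne _ _ hZ).2, h, absurd h hi₄]
    obtain rfl : i' = i₄ := by
      rcases hall i' with h | h | h | h | h
      exacts [absurd h hi₀', absurd h (hne _ _ hZ').1, absurd h (hne _ _ hZ').2, absurd h hi₃', h]
    have hpos : ∀ {l j}, A l j ≠ 0 → 0 < A l j := fun h => lt_of_le_of_ne (hnonneg _ _) h.symm
    obtain ⟨e, ⟨he₁, he₂⟩, he⟩ := exists_separating_value hnonneg hall h₁₀.symm h₂₀.symm h₄₀.symm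
      h₁₃ h₁₄ h₂₃ h₂₄ h₄₃.symm hrow ((hZ i).2 (Or.inr rfl)) (hpos hw₁) (hpos hw₂) hw₃ hc₁ hc₂ hp hS
    obtain ⟨e', ⟨he₁', he₂'⟩, he'⟩ := exists_separating_value hnonneg
      (fun l => by have := hall l; tauto) h₁₀.symm h₂₀.symm h₃₀.symm
      h₁₄ h₁₃ h₂₄ h₂₃ h₄₃ hrow ((hZ' i').2 (Or.inr rfl)) (hpos hu₁) (hpos hu₂) hu₄ hc₁ hc₂ hq hS'
    have hu'₄ : A i' u' ≠ 0 := fun h => by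
      rcases (hZ i').1 h with h | h
      exacts [h₄₀ h, h₄₃ h]
    have hw'₃ : A i w' ≠ 0 := fun h => by
      rcases (hZ' i).1 h with h | h
      exacts [h₃₀ h, h₄₃ h.symm]
    rcases le_total e e' with hle | hle
    · exact he w' hw'₃ ⟨by linarith, by linarith⟩
    · exact he' u' hu'₄ ⟨by linarith, by linarith⟩

end ZeroPatterns

/-- A row translate of a matrix with a lift of rank at most `k` has a lift of rank at most `k`. -/
theorem exists_isLift_of_row_translate {m n k : ℕ} {A B : Matrix (Fin m) (Fin n) ℝ} {d : Fin m → ℝ}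
    (h : ∀ i j, A i j = d i + B i j)
    (hB : ∃ F : Matrix (Fin m) (Fin n) Ktilde, IsLift F B ∧ F.rank ≤ k) :
    ∃ F : Matrix (Fin m) (Fin n) Ktilde, IsLift F A ∧ F.rank ≤ k := by
  obtain ⟨F, hF, hrank⟩ := hB
  refine ⟨Matrix.diagonal (fun i => HahnSeries.single (d i) 1) * F, fun i j => ?_,
    (Matrix.rank_mul_le_right _ _).trans hrank⟩
  have hd : HahnSeries.single (d i) (1 : ℂ) ≠ 0 := HahnSeries.single_ne_zero one_ne_zero
  rw [Matrix.diagonal_mul]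
  refine ⟨mul_ne_zero hd (hF i j).1, ?_⟩
  unfold ord
  rw [HahnSeries.order_mul hd (hF i j).1, HahnSeries.order_single one_ne_zero, h]
  exact congrArg (d i + ·) (hF i j).2

theorem kapRank_of_zero_row_5x5 (A : Matrix (Fin 5) (Fin 5) ℝ)
    (htrop : tropRank A = 3)
    (hrow : ∃ i : Fin 5, ∀ j, A i j = 0)
    (hnonneg : ∀ i j, 0 ≤ A i j)
    (hcol : ∀ j : Fin 5, ∃ i i' : Fin 5, i ≠ i' ∧ A i j = 0 ∧ A i' j = 0) :
    kapRank A = 3 := by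
  have hlift : ∃ F : Matrix (Fin 5) (Fin 5) Ktilde, IsLift F A ∧ F.rank ≤ 3 := by
    obtain ⟨i₀, hi₀⟩ := hrow
    choose c hc using fun i => Finite.exists_min (A i)
    let B : Matrix (Fin 5) (Fin 5) ℝ := Matrix.of fun i j => A i j + -A i (c i)
    have hBzero : ∀ i j, A i j = 0 → B i j = 0 := fun i j h => by
      have h1 := hc i j
      have h2 := hnonneg i (c i)
      simp only [B, Matrix.of_apply]
      linarith
    have hBnonneg : ∀ i j, 0 ≤ B i j := fun i j => by
      have := hc i j
      simp only [B, Matrix.of_apply]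
      linarith
    have hBtrop : tropRank B < 4 := by
      have := tropRank_le_of_row_translate (A := A) (B := B) (d := fun i => -A i (c i))
        fun i j => rfl
      omega
    obtain ⟨r, p, hp, hgen⟩ := exists_generic_dependence hBtrop hBnonneg
      (fun j => hBzero i₀ j (hi₀ j)) fun i => ⟨c i, by simp [B]⟩
    refine exists_isLift_of_row_translate (B := B) (d := fun i => A i (c i)) (fun i j => ?_)
      (exists_isLift_rank_le hBnonneg (fun j => ?_) hp hgen)
    · simp [B]
    · obtain ⟨i, i', hne, h, h'⟩ := hcol j
      exact ⟨i, i', hne, hBzero _ _ h, hBzero _ _ h'⟩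
  refine le_antisymm (Nat.sInf_le hlift) (le_csInf ⟨3, hlift⟩ ?_)
  rintro k ⟨F, hF, hk⟩
  exact htrop ▸ (tropRank_le_rank_of_isLift hF).trans hk
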